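/- Let R be a commutative ring. The following are equivalent: (1) every weak w-projective R-module is projective; (2) every w-projective R-module is projective; (3) every GV-torsion R-module is projective; (4) every GV-torsion-free R-module is a strong w-module; (5) every w-flat R-module of finitely presented type is projective; (6) every weak w-projective R-module is a w-module; (7) R is a DW-ring, i.e., every ideal of R is a w-ideal. -/

import Mathlib

/-!  Background definitions for the `w`-operation theory of Wang–Kim–Qiao.  -/

open CategoryTheory

section WTheory

variable (R : Type) [CommRing R]

/-- `J` is a Glaz–Vasconcelos ideal: it is finitely generated and the natural map
`R → Hom_R(J, R)`, sending `r` to multiplication by `r`, is bijective. -/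
def IsGVIdeal (J : Ideal R) : Prop :=
  J.FG ∧ Function.Bijective fun r : R => (r • J.subtype : J →ₗ[R] R)

/-- `M` is `GV`-torsion: every element is annihilated by some GV-ideal. -/
def IsGVTorsion (M : Type*) [AddCommGroup M] [Module R M] : Prop :=
  ∀ x : M, ∃ J : Ideal R, IsGVIdeal R J ∧ ∀ j ∈ J, j • x = 0

/-- `M` is `GV`-torsion-free: no nonzero element is annihilated by a GV-ideal. -/
def IsGVTorsionFree (M : Type*) [AddCommGroup M] [Module R M] : Prop :=
  ∀ x : M, (∃ J : Ideal R, IsGVIdeal R J ∧ ∀ j ∈ J, j • x = 0) → x = 0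

/-- `Ext^n_R(M, N)`, as an `R`-module. -/
noncomputable def extM (M N : Type) [AddCommGroup M] [Module R M]
    [AddCommGroup N] [Module R N] (n : ℕ) : ModuleCat R :=
  ((Ext R (ModuleCat R) n).obj (Opposite.op (ModuleCat.of R M))).obj (ModuleCat.of R N)

/-- `M` is a `w`-module: it is GV-torsion-free and `Ext^1_R(R/J, M) = 0`
for every GV-ideal `J`. -/
def IsWModule (M : Type) [AddCommGroup M] [Module R M] : Prop :=
  IsGVTorsionFree R M ∧
    ∀ J : Ideal R, IsGVIdeal R J → Subsingleton (extM R (R ⧸ J) M 1)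

/-- `(L, ι)` is a `w`-envelope of `M`: `L` is a `w`-module, `ι : M → L` is an injective
linear map, and its cokernel is GV-torsion. -/
def IsWEnvelope (M L : Type) [AddCommGroup M] [Module R M] [AddCommGroup L]
    [Module R L] (ι : M →ₗ[R] L) : Prop :=
  IsWModule R L ∧ Function.Injective ι ∧ IsGVTorsion R (L ⧸ LinearMap.range ι)

/-- The GV-torsion submodule `tor_GV(M)`.  (The displayed generating set is already closed
under the module operations, since the GV-ideals form a multiplicative system of ideals,
so the span coincides with the displayed set.) -/
def torGV (M : Type) [AddCommGroup M] [Module R M] : Submodule R M :=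
  Submodule.span R {x : M | ∃ J : Ideal R, IsGVIdeal R J ∧ ∀ j ∈ J, j • x = 0}

/-- `M` is `w`-projective: for every GV-torsion-free `w`-module `N` and every
`w`-envelope `(L, ι)` of `M / tor_GV(M)`, the module `Ext^1_R(L, N)` is GV-torsion. -/
def IsWProjective (M : Type) [AddCommGroup M] [Module R M] : Prop :=
  ∀ (N : Type) [AddCommGroup N] [Module R N], IsGVTorsionFree R N → IsWModule R N →
    ∀ (L : Type) [AddCommGroup L] [Module R L] (ι : (M ⧸ torGV R M) →ₗ[R] L),
      IsWEnvelope R (M ⧸ torGV R M) L ι → IsGVTorsion R (extM R L N 1)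

/-- `N` belongs to the class `P_w^{†∞}`: it is GV-torsion-free and
`Ext^k_R(M, N) = 0` for every `w`-projective `M` and every `k ≥ 1`. -/
def MemPwDaggerInfty (N : Type) [AddCommGroup N] [Module R N] : Prop :=
  IsGVTorsionFree R N ∧
    ∀ (M : Type) [AddCommGroup M] [Module R M], IsWProjective R M →
      ∀ k : ℕ, 1 ≤ k → Subsingleton (extM R M N k)

/-- `M` is weak `w`-projective: `Ext^1_R(M, N) = 0` for every `N ∈ P_w^{†∞}`. -/
def IsWeakWProjective (M : Type) [AddCommGroup M] [Module R M] : Prop :=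
  ∀ (N : Type) [AddCommGroup N] [Module R N], MemPwDaggerInfty R N →
    Subsingleton (extM R M N 1)

end WTheory

section WExactness

variable (R : Type) [CommRing R]

/-- `I` is a `w`-ideal of `R`. -/
def IsWIdeal (I : Ideal R) : Prop :=
  ∀ x : R, (∃ J : Ideal R, IsGVIdeal R J ∧ ∀ j ∈ J, j * x ∈ I) → x ∈ I

/-- `P` is a maximal `w`-ideal: it is maximal among proper `w`-ideals of `R`.
(Every maximal `w`-ideal is a prime ideal.) -/
def IsMaxWIdeal (P : Ideal R) : Prop :=
  IsWIdeal R P ∧ P ≠ ⊤ ∧ ∀ I : Ideal R, IsWIdeal R I → I ≠ ⊤ → P ≤ I → I = P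

/-- The localization of a linear map at a submonoid. -/
noncomputable def locMap (S : Submonoid R) {A B : Type} [AddCommGroup A] [Module R A]
    [AddCommGroup B] [Module R B] (f : A →ₗ[R] B) :
    LocalizedModule S A →ₗ[R] LocalizedModule S B :=
  IsLocalizedModule.map S (LocalizedModule.mkLinearMap S A) (LocalizedModule.mkLinearMap S B) f

/-- `f` is a `w`-monomorphism: its localization at every maximal `w`-ideal is injective. -/
def IsWMono {A B : Type} [AddCommGroup A] [Module R A] [AddCommGroup B] [Module R B]
    (f : A →ₗ[R] B) : Prop :=
  ∀ (P : Ideal R), IsMaxWIdeal R P → ∀ [P.IsPrime],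
    Function.Injective (locMap R P.primeCompl f)

/-- `f` is a `w`-epimorphism: its localization at every maximal `w`-ideal is surjective. -/
def IsWEpi {A B : Type} [AddCommGroup A] [Module R A] [AddCommGroup B] [Module R B]
    (f : A →ₗ[R] B) : Prop :=
  ∀ (P : Ideal R), IsMaxWIdeal R P → ∀ [P.IsPrime],
    Function.Surjective (locMap R P.primeCompl f)

/-- `0 → A → B → C → 0` is a `w`-exact sequence: its localization at every maximal
`w`-ideal is a short exact sequence. -/
def IsWShortExact {A B C : Type} [AddCommGroup A] [Module R A] [AddCommGroup B] [Module R B]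
    [AddCommGroup C] [Module R C] (f : A →ₗ[R] B) (g : B →ₗ[R] C) : Prop :=
  ∀ (P : Ideal R), IsMaxWIdeal R P → ∀ [P.IsPrime],
    Function.Injective (locMap R P.primeCompl f) ∧
    Function.Exact (locMap R P.primeCompl f) (locMap R P.primeCompl g) ∧
    Function.Surjective (locMap R P.primeCompl g)

/-- `M` is of finite type: there is a `w`-epimorphism from a finitely generated free module. -/
def IsFiniteType (M : Type) [AddCommGroup M] [Module R M] : Prop :=
  ∃ (n : ℕ) (g : (Fin n → R) →ₗ[R] M), IsWEpi R g

/-- `M` is of finitely presented type: there is a `w`-exact sequence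
`F₁ → F₀ → M → 0` with `F₁`, `F₀` finitely generated free. -/
def IsFinitelyPresentedType (M : Type) [AddCommGroup M] [Module R M] : Prop :=
  ∃ (m n : ℕ) (f : (Fin m → R) →ₗ[R] (Fin n → R)) (g : (Fin n → R) →ₗ[R] M),
    IsWEpi R g ∧ ∀ (P : Ideal R), IsMaxWIdeal R P → ∀ [P.IsPrime],
      Function.Exact (locMap R P.primeCompl f) (locMap R P.primeCompl g)

/-- `M` is `w`-flat: tensoring with `M` preserves `w`-monomorphisms. -/
def IsWFlat (M : Type) [AddCommGroup M] [Module R M] : Prop :=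
  ∀ (A B : Type) [AddCommGroup A] [Module R A] [AddCommGroup B] [Module R B]
    (f : A →ₗ[R] B), IsWMono R f → IsWMono R (LinearMap.lTensor M f)

end WExactness

/-- `M` is a strong `w`-module: it is GV-torsion-free and `Ext^i_R(N, M) = 0` for every
`i ≥ 1` and every GV-torsion module `N`. -/
def IsStrongWModule (R : Type) [CommRing R] (M : Type) [AddCommGroup M] [Module R M] : Prop :=
  IsGVTorsionFree R M ∧
    ∀ (N : Type) [AddCommGroup N] [Module R N], IsGVTorsion R N →
      ∀ i : ℕ, 1 ≤ i → Subsingleton (extM R N M i)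

/-- If `Ext¹(X₃, X₁)` vanishes, a short exact sequence `0 → X₁ → X₂ → X₃ → 0` splits. -/
theorem CategoryTheory.ShortComplex.ShortExact.exists_section_of_isZero_ext
    {R C : Type*} [Ring R] [Category* C] [Abelian C] [Linear R C] [EnoughProjectives C]
    {S : ShortComplex C} (hS : S.ShortExact)
    (h : Limits.IsZero (((Ext R C 1).obj (Opposite.op S.X₃)).obj S.X₁)) :
    ∃ s : S.X₃ ⟶ S.X₂, s ≫ S.g = 𝟙 S.X₃ := by
  have := hS.mono_f
  have := hS.epi_g
  let P := projectiveResolution S.X₃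
  have hP := Limits.IsZero.of_iso h (P.isoExt (R := R) 1 S.X₁).symm
  rw [← HomologicalComplex.exactAt_iff_isZero_homology,
    HomologicalComplex.exactAt_iff' _ 0 1 2 (by simp) (by simp),
    ShortComplex.moduleCat_exact_iff] at hP
  let π : P.complex.X 0 ⟶ S.X₃ := P.π.f 0
  have hdπ : P.complex.d 1 0 ≫ π = 0 := P.complex_d_comp_π_f_zero
  let a : P.complex.X 0 ⟶ S.X₂ := Projective.factorThru π S.g
  have ha : a ≫ S.g = π := Projective.factorThru_comp _ _
  have hda : (P.complex.d 1 0 ≫ a) ≫ S.g = 0 := by rw [Category.assoc, ha, hdπ]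
  let b : P.complex.X 1 ⟶ S.X₁ := hS.exact.lift _ hda
  have hb : b ≫ S.f = P.complex.d 1 0 ≫ a := hS.exact.lift_f _ hda
  have hdb : P.complex.d 2 1 ≫ b = 0 := by
    rw [← cancel_mono S.f, Category.assoc, hb]
    simp
  obtain ⟨c, hc⟩ : ∃ c : P.complex.X 0 ⟶ S.X₁, P.complex.d 1 0 ≫ c = b := hP b hdb
  have hk : P.complex.d 1 0 ≫ (a - c ≫ S.f) = 0 := by
    rw [Preadditive.comp_sub, ← Category.assoc, hc, hb, sub_self]
  have hπ : Epi π := inferInstanceAs (Epi (P.π.f 0))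
  let s : S.X₃ ⟶ S.X₂ := P.exact₀.desc (a - c ≫ S.f) hk
  have hs : π ≫ s = a - c ≫ S.f := P.exact₀.g_desc _ hk
  refine ⟨s, ?_⟩
  rw [← cancel_epi π, ← Category.assoc, hs]
  simp [ha]

section Ext

variable {R : Type} [CommRing R]

/-- If `Ext¹(M, N)` vanishes, every extension of `M` by `N` has a linear section. -/
theorem exists_section_of_subsingleton_extM {N E M : Type} [AddCommGroup N] [Module R N]
    [AddCommGroup E] [Module R E] [AddCommGroup M] [Module R M] {f : N →ₗ[R] E} {g : E →ₗ[R] M}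
    (hf : Function.Injective f) (hfg : Function.Exact f g) (hg : Function.Surjective g)
    (h : Subsingleton (extM R M N 1)) :
    ∃ s : M →ₗ[R] E, g ∘ₗ s = LinearMap.id := by
  let S : ShortComplex (ModuleCat R) :=
    ShortComplex.mk (ModuleCat.ofHom f) (ModuleCat.ofHom g)
      (by ext x; exact hfg.apply_apply_eq_zero x)
  have hS : S.ShortExact := ModuleCat.shortComplex_shortExact S hfg hf hg
  have hz : Limits.IsZero (((Ext R (ModuleCat R) 1).obj (Opposite.op S.X₃)).obj S.X₁) :=
    ModuleCat.isZero_of_iff_subsingleton.mpr h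
  obtain ⟨s, hs⟩ := hS.exists_section_of_isZero_ext hz
  exact ⟨s.hom, congrArg ModuleCat.Hom.hom hs⟩

theorem subsingleton_extM_of_projective (M N : Type) [AddCommGroup M] [Module R M]
    [AddCommGroup N] [Module R N] [Module.Projective R M] {n : ℕ} (hn : 1 ≤ n) :
    Subsingleton (extM R M N n) := by
  obtain ⟨k, rfl⟩ := Nat.exists_eq_add_of_le' hn
  have : Projective (ModuleCat.of R M) :=
    (IsProjective.iff_projective (R := R) (P := M)).mp inferInstance
  exact ModuleCat.subsingleton_of_isZero
    (isZero_Ext_succ_of_projective (R := R) (ModuleCat.of R M) (ModuleCat.of R N) k)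

theorem projective_of_forall_subsingleton_extM (M : Type) [AddCommGroup M] [Module R M]
    (h : ∀ (N : Type) [AddCommGroup N] [Module R N], Subsingleton (extM R M N 1)) :
    Module.Projective R M := by
  let g : (M →₀ R) →ₗ[R] M := Finsupp.linearCombination R id
  obtain ⟨s, hs⟩ := exists_section_of_subsingleton_extM (N := LinearMap.ker g)
    (f := (LinearMap.ker g).subtype) (g := g) (Submodule.subtype_injective _)
    g.exact_subtype_ker_map
    (Finsupp.linearCombination_id_surjective R M) (h _)
  exact Module.Projective.of_split s g hs

end Ext

section GV

variable {R : Type} [CommRing R]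

theorem IsGVIdeal.eq_zero_of_forall_mul_eq_zero {J : Ideal R} (hJ : IsGVIdeal R J) {r : R}
    (h : ∀ j ∈ J, r * j = 0) : r = 0 :=
  hJ.2.1 (LinearMap.ext fun j => by simpa using h j j.2)

theorem isGVTorsionFree_ideal (I : Ideal R) : IsGVTorsionFree R I := by
  rintro x ⟨J, hJ, hx⟩
  refine Subtype.ext (hJ.eq_zero_of_forall_mul_eq_zero fun j hj => ?_)
  simpa [mul_comm] using congrArg Subtype.val (hx j hj)

theorem Ideal.smul_quotient_eq_zero {J : Ideal R} :
    ∀ j ∈ J, ∀ x : R ⧸ J, j • x = 0 := by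
  intro j hj x
  obtain ⟨r, rfl⟩ := Ideal.Quotient.mk_surjective x
  exact Ideal.Quotient.eq_zero_iff_mem.mpr (J.mul_mem_right r hj)

theorem isGVTorsion_of_subsingleton (M : Type*) [AddCommGroup M]
    [Module R M] [Subsingleton M] : IsGVTorsion R M := fun _ =>
  ⟨⊤, ⟨Ideal.fg_top R, by
    refine ⟨fun a b hab => by simpa using LinearMap.congr_fun hab ⟨1, trivial⟩, fun f => ?_⟩
    refine ⟨f ⟨1, trivial⟩, LinearMap.ext fun j => ?_⟩
    have hj : j = (j : R) • (⟨1, trivial⟩ : (⊤ : Ideal R)) := Subtype.ext (by simp)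
    conv_rhs => rw [hj, map_smul]
    simp [mul_comm]⟩, fun _ _ => Subsingleton.elim _ _⟩

theorem IsGVIdeal.isGVTorsion_quotient {J : Ideal R} (hJ : IsGVIdeal R J) :
    IsGVTorsion R (R ⧸ J) :=
  fun x => ⟨J, hJ, fun j hj => Ideal.smul_quotient_eq_zero j hj x⟩

/-- A GV-ideal `J` is the unit ideal as soon as `R → R ⧸ J` has a linear section. -/
theorem IsGVIdeal.eq_top_of_section {J : Ideal R} (hJ : IsGVIdeal R J) (s : (R ⧸ J) →ₗ[R] R)
    (hs : J.mkQ ∘ₗ s = LinearMap.id) : J = ⊤ := by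
  have h0 : s (J.mkQ 1) = 0 := hJ.eq_zero_of_forall_mul_eq_zero fun j hj => by
    have : j • J.mkQ (1 : R) = 0 := by
      rw [← map_smul, Submodule.mkQ_apply, Submodule.Quotient.mk_eq_zero]
      simpa using hj
    rw [mul_comm, ← smul_eq_mul, ← map_smul, this, map_zero]
  have h1 : J.mkQ (s (J.mkQ 1)) = J.mkQ 1 := LinearMap.congr_fun hs _
  rw [h0, map_zero, eq_comm, Submodule.mkQ_apply, Submodule.Quotient.mk_eq_zero] at h1
  exact (Ideal.eq_top_iff_one J).mpr h1

theorem IsGVIdeal.eq_top_of_projective {J : Ideal R} (hJ : IsGVIdeal R J)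
    (h : Module.Projective R (R ⧸ J)) : J = ⊤ := by
  obtain ⟨s, hs⟩ := Module.projective_lifting_property J.mkQ LinearMap.id J.mkQ_surjective
  exact hJ.eq_top_of_section s hs

theorem isWIdeal_of_forall_eq_top (h : ∀ J : Ideal R, IsGVIdeal R J → J = ⊤) (I : Ideal R) :
    IsWIdeal R I := by
  rintro x ⟨J, hJ, hx⟩
  simpa using hx 1 (by simp [h J hJ])

theorem IsGVIdeal.eq_top_of_isWIdeal_of_le {I J : Ideal R} (hJ : IsGVIdeal R J)
    (hI : IsWIdeal R I) (hJI : J ≤ I) : I = ⊤ :=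
  (Ideal.eq_top_iff_one I).mpr (hI 1 ⟨J, hJ, fun j hj => by simpa using hJI hj⟩)

section TrivialGVIdeals

theorem eq_zero_of_forall_eq_top (h : ∀ J : Ideal R, IsGVIdeal R J → J = ⊤)
    {M : Type*} [AddCommGroup M] [Module R M] {x : M}
    (hx : ∃ J : Ideal R, IsGVIdeal R J ∧ ∀ j ∈ J, j • x = 0) : x = 0 := by
  obtain ⟨J, hJ, hx⟩ := hx
  simpa using hx 1 (by simp [h J hJ])

theorem IsGVTorsion.subsingleton (h : ∀ J : Ideal R, IsGVIdeal R J → J = ⊤)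
    {M : Type*} [AddCommGroup M] [Module R M] (hM : IsGVTorsion R M) : Subsingleton M :=
  subsingleton_of_forall_eq 0 fun x => eq_zero_of_forall_eq_top h (hM x)

theorem isWModule_of_forall_eq_top (h : ∀ J : Ideal R, IsGVIdeal R J → J = ⊤)
    (M : Type) [AddCommGroup M] [Module R M] : IsWModule R M := by
  refine ⟨fun x hx => eq_zero_of_forall_eq_top h hx, fun J hJ => ?_⟩
  have := hJ.isGVTorsion_quotient.subsingleton h
  exact subsingleton_extM_of_projective _ _ le_rfl

theorem torGV_eq_bot (h : ∀ J : Ideal R, IsGVIdeal R J → J = ⊤)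
    (M : Type) [AddCommGroup M] [Module R M] : torGV R M = ⊥ :=
  Submodule.span_eq_bot.mpr fun _ hx => eq_zero_of_forall_eq_top h hx

theorem IsWProjective.projective (h : ∀ J : Ideal R, IsGVIdeal R J → J = ⊤)
    {M : Type} [AddCommGroup M] [Module R M] (hM : IsWProjective R M) :
    Module.Projective R M := by
  have hQ : Module.Projective R (M ⧸ torGV R M) := by
    refine projective_of_forall_subsingleton_extM _ fun N _ _ => ?_
    have hN := isWModule_of_forall_eq_top h N
    have : Subsingleton ((M ⧸ torGV R M) ⧸ LinearMap.range
        (LinearMap.id : (M ⧸ torGV R M) →ₗ[R] _)) := by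
      rw [LinearMap.range_id]
      infer_instance
    exact (hM N hN.1 hN _ LinearMap.id ⟨isWModule_of_forall_eq_top h _,
      Function.injective_id, isGVTorsion_of_subsingleton _⟩).subsingleton h
  exact Module.Projective.of_equiv (Submodule.quotEquivOfEqBot _ (torGV_eq_bot h M))

theorem IsWeakWProjective.projective (h : ∀ J : Ideal R, IsGVIdeal R J → J = ⊤)
    {M : Type} [AddCommGroup M] [Module R M] (hM : IsWeakWProjective R M) :
    Module.Projective R M :=
  projective_of_forall_subsingleton_extM M fun N _ _ =>
    hM N ⟨fun _ hx => eq_zero_of_forall_eq_top h hx, fun K _ _ hK _ hk =>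
      have := hK.projective h
      subsingleton_extM_of_projective K N hk⟩

theorem isMaxWIdeal_of_isMaximal (h : ∀ I : Ideal R, IsWIdeal R I) (P : Ideal R)
    [hP : P.IsMaximal] : IsMaxWIdeal R P :=
  ⟨h P, hP.ne_top, fun _ _ hI hPI => (hP.eq_of_le hI hPI).symm⟩

theorem isWMono_of_injective {A B : Type} [AddCommGroup A] [Module R A] [AddCommGroup B]
    [Module R B] {f : A →ₗ[R] B} (hf : Function.Injective f) : IsWMono R f := fun P _ _ =>
  IsLocalizedModule.map_injective P.primeCompl _ _ f hf

theorem IsWMono.injective (h : ∀ I : Ideal R, IsWIdeal R I) {A B : Type} [AddCommGroup A]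
    [Module R A] [AddCommGroup B] [Module R B] {f : A →ₗ[R] B} (hf : IsWMono R f) :
    Function.Injective f :=
  injective_of_isLocalized_maximal _ (fun _ _ => LocalizedModule.mkLinearMap _ _) _
    (fun _ _ => LocalizedModule.mkLinearMap _ _) f fun P _ => hf P (isMaxWIdeal_of_isMaximal h P)

theorem IsWFlat.flat (h : ∀ I : Ideal R, IsWIdeal R I) {M : Type} [AddCommGroup M]
    [Module R M] (hM : IsWFlat R M) : Module.Flat R M :=
  Module.Flat.iff_lTensor_preserves_injective_linearMap.mpr fun A B _ _ _ _ f hf =>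
    (hM A B f (isWMono_of_injective hf)).injective h

theorem IsFinitelyPresentedType.finitePresentation (h : ∀ I : Ideal R, IsWIdeal R I) {M : Type}
    [AddCommGroup M] [Module R M] (hM : IsFinitelyPresentedType R M) :
    Module.FinitePresentation R M := by
  obtain ⟨m, n, f, g, hg, hfg⟩ := hM
  have hg' : Function.Surjective g :=
    surjective_of_isLocalized_maximal _ (fun _ _ => LocalizedModule.mkLinearMap _ _) _
      (fun _ _ => LocalizedModule.mkLinearMap _ _) g
      fun P _ => hg P (isMaxWIdeal_of_isMaximal h P)
  have hfg' : Function.Exact f g :=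
    exact_of_isLocalized_maximal _ (fun _ _ => LocalizedModule.mkLinearMap _ _) _
      (fun _ _ => LocalizedModule.mkLinearMap _ _) _
      (fun _ _ => LocalizedModule.mkLinearMap _ _) f g
      fun P _ => hfg P (isMaxWIdeal_of_isMaximal h P)
  refine Module.finitePresentation_of_surjective g hg' ?_
  rw [hfg'.linearMap_ker_eq, LinearMap.range_eq_map]
  exact Module.Finite.fg_top.map f

end TrivialGVIdeals

theorem IsGVTorsion.isWProjective {M : Type} [AddCommGroup M] [Module R M]
    (hM : IsGVTorsion R M) : IsWProjective R M := by
  intro N _ _ _ _ L _ _ ι hL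
  have htop : torGV R M = ⊤ := top_le_iff.mp fun x _ => Submodule.subset_span (hM x)
  have : Subsingleton (M ⧸ torGV R M) := Submodule.Quotient.subsingleton_iff.mpr htop
  have : Subsingleton L := subsingleton_of_forall_eq 0 fun x => by
    obtain ⟨J, hJ, hx⟩ := hL.2.2 (Submodule.Quotient.mk x)
    refine hL.1.1 x ⟨J, hJ, fun j hj => ?_⟩
    obtain ⟨y, hy⟩ : j • x ∈ LinearMap.range ι :=
      (Submodule.Quotient.mk_eq_zero _).mp (hx j hj)
    rw [← hy, Subsingleton.elim y 0, map_zero]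
  have := subsingleton_extM_of_projective (R := R) L N le_rfl
  exact isGVTorsion_of_subsingleton _

theorem IsWProjective.isWeakWProjective {M : Type} [AddCommGroup M] [Module R M]
    (hM : IsWProjective R M) : IsWeakWProjective R M :=
  fun _ _ _ hN => hN.2 M hM 1 le_rfl

theorem IsGVIdeal.subsingleton_localizedModule {J : Ideal R} (hJ : IsGVIdeal R J) {P : Ideal R}
    (hP : IsMaxWIdeal R P) [P.IsPrime] {M : Type} [AddCommGroup M] [Module R M]
    (hM : ∀ j ∈ J, ∀ x : M, j • x = 0) : Subsingleton (LocalizedModule P.primeCompl M) := by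
  obtain ⟨j, hj, hjP⟩ : ∃ j ∈ J, j ∉ P := by
    by_contra! hle
    exact hP.2.1 (hJ.eq_top_of_isWIdeal_of_le hP.1 hle)
  exact LocalizedModule.subsingleton_iff.mpr fun x => ⟨j, hjP, hM j hj x⟩

theorem IsGVIdeal.isFinitelyPresentedType_quotient {J : Ideal R} (hJ : IsGVIdeal R J) :
    IsFinitelyPresentedType R (R ⧸ J) := by
  refine ⟨0, 0, 0, 0, fun P hP _ x => ?_, fun P hP _ x => ?_⟩
  · have := hJ.subsingleton_localizedModule hP (Ideal.smul_quotient_eq_zero (J := J))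
    exact ⟨0, Subsingleton.elim _ _⟩
  · have := hJ.subsingleton_localizedModule hP (Ideal.smul_quotient_eq_zero (J := J))
    have := hJ.subsingleton_localizedModule hP (M := Fin 0 → R)
      fun _ _ _ => Subsingleton.elim _ _
    exact ⟨fun _ => ⟨0, Subsingleton.elim _ _⟩, fun _ => Subsingleton.elim _ _⟩

theorem IsGVIdeal.isWFlat_quotient {J : Ideal R} (hJ : IsGVIdeal R J) :
    IsWFlat R (R ⧸ J) := by
  intro A B _ _ _ _ f _ P hP _
  have := hJ.subsingleton_localizedModule hP (M := TensorProduct R (R ⧸ J) A) fun j hj x => by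
    induction x with
    | zero => simp
    | tmul a b =>
      rw [TensorProduct.smul_tmul', Ideal.smul_quotient_eq_zero j hj, TensorProduct.zero_tmul]
    | add a b ha hb => rw [smul_add, ha, hb, add_zero]
  exact Function.injective_of_subsingleton _

end GV

/-- characterizations of `DW`-rings. -/
theorem tfae_DW_ring (R : Type) [CommRing R] :
    List.TFAE
      [∀ (M : Type) [AddCommGroup M] [Module R M],
          IsWeakWProjective R M → Module.Projective R M,
        ∀ (M : Type) [AddCommGroup M] [Module R M],
          IsWProjective R M → Module.Projective R M,
        ∀ (M : Type) [AddCommGroup M] [Module R M],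
          IsGVTorsion R M → Module.Projective R M,
        ∀ (M : Type) [AddCommGroup M] [Module R M],
          IsGVTorsionFree R M → IsStrongWModule R M,
        ∀ (M : Type) [AddCommGroup M] [Module R M],
          IsFinitelyPresentedType R M → IsWFlat R M → Module.Projective R M,
        ∀ (M : Type) [AddCommGroup M] [Module R M],
          IsWeakWProjective R M → IsWModule R M,
        ∀ I : Ideal R, IsWIdeal R I] := by
  tfae_have 1 → 2 := fun h M _ _ hM => h M hM.isWeakWProjective
  tfae_have 2 → 3 := fun h M _ _ hM => h M hM.isWProjective
  tfae_have 3 → 7 := fun h => isWIdeal_of_forall_eq_top fun J hJ =>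
    hJ.eq_top_of_projective (h _ hJ.isGVTorsion_quotient)
  tfae_have 4 → 7 := fun h => isWIdeal_of_forall_eq_top fun J hJ => by
    obtain ⟨s, hs⟩ := exists_section_of_subsingleton_extM (f := J.subtype) (g := J.mkQ)
      J.subtype_injective (LinearMap.exact_subtype_mkQ J) J.mkQ_surjective
      ((h J (isGVTorsionFree_ideal J)).2 (R ⧸ J) hJ.isGVTorsion_quotient 1 le_rfl)
    exact hJ.eq_top_of_section s hs
  tfae_have 5 → 7 := fun h => isWIdeal_of_forall_eq_top fun J hJ =>
    hJ.eq_top_of_projective (h _ hJ.isFinitelyPresentedType_quotient hJ.isWFlat_quotient)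
  tfae_have 6 → 7 := fun h => isWIdeal_of_forall_eq_top fun J hJ =>
    (Ideal.eq_top_iff_one J).mpr <| Ideal.Quotient.eq_zero_iff_mem.mp <|
      (h _ hJ.isGVTorsion_quotient.isWProjective.isWeakWProjective).1 1
        (hJ.isGVTorsion_quotient 1)
  tfae_have 7 → 1 := fun h M _ _ hM =>
    hM.projective fun J hJ => hJ.eq_top_of_isWIdeal_of_le (h J) le_rfl
  tfae_have 7 → 4 := fun h M _ _ hM => ⟨hM, fun N _ _ hN i hi =>
    have := hN.subsingleton fun J hJ => hJ.eq_top_of_isWIdeal_of_le (h J) le_rfl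
    subsingleton_extM_of_projective N M hi⟩
  tfae_have 7 → 5 := fun h M _ _ hfp hfl =>
    have := hfp.finitePresentation h
    have := hfl.flat h
    Module.Flat.projective_of_finitePresentation
  tfae_have 7 → 6 := fun h M _ _ _ =>
    isWModule_of_forall_eq_top (fun J hJ => hJ.eq_top_of_isWIdeal_of_le (h J) le_rfl) M
  tfae_finish
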